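/- arXiv:2505.01159 — 2 statements merged into one kernel-verified Lean document; each statement's English description precedes it below -/
import Mathlib

section
/- (Diffusion–convection–reaction regime ε₁ ≪ ε₂².) Let ε₁, ε₂ be real numbers with 0 < ε₁ ≤ ε₂² and ε₂ > 0, and let d, r, γ, D, r₀, R be real numbers with 0 < γ ≤ d ≤ D and 0 < r₀ ≤ r ≤ R. Define μ_L = (−ε₂·d + √(ε₂²·d² + 4·ε₁·r))/(2·ε₁) and μ_R = (ε₂·d + √(ε₂²·d² + 4·ε₁·r))/(2·ε₁). Then 2·r₀/(ε₂·(D + √(D² + 4·R))) ≤ μ_L ≤ R/(γ·ε₂), and γ·ε₂/ε₁ ≤ μ_R ≤ ε₂·(D + √(D² + 4·R))/(2·ε₁). -/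
theorem stmt_3 (ε₁ ε₂ d r γ D r₀ R μL μR : ℝ)
    (hε₁ : 0 < ε₁) (hε₂ : 0 < ε₂) (hε₁ε₂ : ε₁ ≤ ε₂ ^ 2)
    (hγ : 0 < γ) (hγd : γ ≤ d) (hdD : d ≤ D)
    (hr₀ : 0 < r₀) (hr₀r : r₀ ≤ r) (hrR : r ≤ R)
    (hμL : μL = (-(ε₂ * d) + Real.sqrt (ε₂ ^ 2 * d ^ 2 + 4 * ε₁ * r)) / (2 * ε₁))
    (hμR : μR = (ε₂ * d + Real.sqrt (ε₂ ^ 2 * d ^ 2 + 4 * ε₁ * r)) / (2 * ε₁)) :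
    (2 * r₀ / (ε₂ * (D + Real.sqrt (D ^ 2 + 4 * R))) ≤ μL ∧ μL ≤ R / (γ * ε₂)) ∧
      (γ * ε₂ / ε₁ ≤ μR ∧ μR ≤ ε₂ * (D + Real.sqrt (D ^ 2 + 4 * R)) / (2 * ε₁)) := by
  have hd : 0 < d := by linarith
  have hr : 0 < r := by linarith
  have hD : 0 < D := by linarith
  have hR : 0 < R := by linarith
  have hT0 : 0 ≤ Real.sqrt (D ^ 2 + 4 * R) := Real.sqrt_nonneg _
  have hS2 : Real.sqrt (ε₂ ^ 2 * d ^ 2 + 4 * ε₁ * r) ^ 2 = ε₂ ^ 2 * d ^ 2 + 4 * ε₁ * r :=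
    Real.sq_sqrt (by positivity)
  have hSlo : ε₂ * d ≤ Real.sqrt (ε₂ ^ 2 * d ^ 2 + 4 * ε₁ * r) := by
    apply Real.le_sqrt_of_sq_le
    have : 0 < ε₁ * r := by positivity
    nlinarith
  have hShi : Real.sqrt (ε₂ ^ 2 * d ^ 2 + 4 * ε₁ * r) ≤ ε₂ * Real.sqrt (D ^ 2 + 4 * R) := by
    apply Real.sqrt_le_iff.mpr
    refine ⟨by positivity, ?_⟩
    rw [mul_pow, Real.sq_sqrt (by positivity)]
    have h1 : ε₂ ^ 2 * d ^ 2 ≤ ε₂ ^ 2 * D ^ 2 := by gcongr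
    have h2 : ε₁ * r ≤ ε₂ ^ 2 * R := by gcongr
    linarith
  generalize Real.sqrt (ε₂ ^ 2 * d ^ 2 + 4 * ε₁ * r) = S at *
  generalize Real.sqrt (D ^ 2 + 4 * R) = T at *
  have hed : 0 < ε₂ * d := by positivity
  have heD : ε₂ * d ≤ ε₂ * D := by gcongr
  have heg : γ * ε₂ ≤ ε₂ * d := by nlinarith
  have hge : 0 < γ * ε₂ := by positivity
  have hsum : 0 < ε₂ * d + S := by linarith
  have hL : μL = 2 * r / (ε₂ * d + S) := by
    rw [hμL, div_eq_div_iff (by positivity) hsum.ne']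
    linear_combination hS2
  refine ⟨⟨?_, ?_⟩, ?_, ?_⟩
  · rw [hL]
    apply div_le_div₀ <;> linarith
  · rw [hL, show R / (γ * ε₂) = 2 * R / (2 * (γ * ε₂)) by field_simp]
    apply div_le_div₀ <;> linarith
  · rw [hμR, show γ * ε₂ / ε₁ = 2 * (γ * ε₂) / (2 * ε₁) by field_simp]
    apply div_le_div_of_nonneg_right <;> linarith
  · rw [hμR]
    apply div_le_div_of_nonneg_right <;> linarith
end

section
/- (Reaction–diffusion regime ε₂² ≪ ε₁.) Let ε₁, ε₂ be real numbers with ε₂ ≥ 0, ε₁ > 0 and ε₂² ≤ ε₁, and let d, r, γ, D, r₀, R be real numbers with 0 < γ ≤ d ≤ D and 0 < r₀ ≤ r ≤ R. Define μ_L = (−ε₂·d + √(ε₂²·d² + 4·ε₁·r))/(2·ε₁) and μ_R = (ε₂·d + √(ε₂²·d² + 4·ε₁·r))/(2·ε₁). Then 2·r₀/(√ε₁·(D + √(D² + 4·R))) ≤ μ_L ≤ R/√(ε₁·r₀), and √(r₀/ε₁) ≤ μ_R ≤ (D + √(D² + 4·R))/(2·√ε₁). -/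
theorem stmt_4 (ε₁ ε₂ d r γ D r₀ R μL μR : ℝ)
    (hε₂ : 0 ≤ ε₂) (hε₁ : 0 < ε₁) (hε₂ε₁ : ε₂ ^ 2 ≤ ε₁)
    (hγ : 0 < γ) (hγd : γ ≤ d) (hdD : d ≤ D)
    (hr₀ : 0 < r₀) (hr₀r : r₀ ≤ r) (hrR : r ≤ R)
    (hμL : μL = (-(ε₂ * d) + Real.sqrt (ε₂ ^ 2 * d ^ 2 + 4 * ε₁ * r)) / (2 * ε₁))
    (hμR : μR = (ε₂ * d + Real.sqrt (ε₂ ^ 2 * d ^ 2 + 4 * ε₁ * r)) / (2 * ε₁)) :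
    (2 * r₀ / (Real.sqrt ε₁ * (D + Real.sqrt (D ^ 2 + 4 * R))) ≤ μL ∧
        μL ≤ R / Real.sqrt (ε₁ * r₀)) ∧
      (Real.sqrt (r₀ / ε₁) ≤ μR ∧
        μR ≤ (D + Real.sqrt (D ^ 2 + 4 * R)) / (2 * Real.sqrt ε₁)) := by
  have hd : 0 < d := lt_of_lt_of_le hγ hγd
  have hD : 0 < D := lt_of_lt_of_le hd hdD
  have hr : 0 < r := lt_of_lt_of_le hr₀ hr₀r
  have hR : 0 < R := lt_of_lt_of_le hr hrR
  have hs : 0 < Real.sqrt ε₁ := Real.sqrt_pos.mpr hε₁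
  have hq : 0 < Real.sqrt r₀ := Real.sqrt_pos.mpr hr₀
  have hS2 : Real.sqrt (ε₂ ^ 2 * d ^ 2 + 4 * ε₁ * r) ^ 2 = ε₂ ^ 2 * d ^ 2 + 4 * ε₁ * r :=
    Real.sq_sqrt (by positivity)
  have hS : 0 < Real.sqrt (ε₂ ^ 2 * d ^ 2 + 4 * ε₁ * r) := Real.sqrt_pos.mpr (by positivity)
  have hT2 : Real.sqrt (D ^ 2 + 4 * R) ^ 2 = D ^ 2 + 4 * R := Real.sq_sqrt (by positivity)
  have hT : 0 < Real.sqrt (D ^ 2 + 4 * R) := Real.sqrt_pos.mpr (by positivity)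
  have hs2 : Real.sqrt ε₁ ^ 2 = ε₁ := Real.sq_sqrt hε₁.le
  have hq2 : Real.sqrt r₀ ^ 2 = r₀ := Real.sq_sqrt hr₀.le
  have he : ε₂ ≤ Real.sqrt ε₁ := Real.le_sqrt_of_sq_le hε₂ε₁
  rw [Real.sqrt_mul hε₁.le, Real.sqrt_div hr₀.le]
  generalize Real.sqrt (ε₂ ^ 2 * d ^ 2 + 4 * ε₁ * r) = S at *
  generalize Real.sqrt (D ^ 2 + 4 * R) = T at *
  generalize Real.sqrt ε₁ = s at *
  generalize Real.sqrt r₀ = q at *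
  have ha0 : 0 ≤ ε₂ * d := by positivity
  have ha : ε₂ * d ≤ s * D := by gcongr
  have hST : S ≤ s * T := by
    refine (sq_le_sq₀ hS.le (by positivity)).mp ?_
    rw [hS2, mul_pow, hs2, hT2]
    have h1 : ε₂ ^ 2 * d ^ 2 ≤ ε₁ * D ^ 2 := by gcongr
    have h2 : ε₁ * r ≤ ε₁ * R := by gcongr
    linarith
  have hSq : 2 * (s * q) ≤ S := by
    refine (sq_le_sq₀ (by positivity) hS.le).mp ?_
    rw [hS2, mul_pow, mul_pow, hs2, hq2]
    have h2 : ε₁ * r₀ ≤ ε₁ * r := by gcongr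
    have h1 : 0 ≤ ε₂ ^ 2 * d ^ 2 := by positivity
    linarith
  have hL : μL = 2 * r / (ε₂ * d + S) := by
    rw [hμL, div_eq_div_iff (by positivity) (by positivity)]
    linear_combination hS2
  have hsum : ε₂ * d + S ≤ s * (D + T) := by linarith
  refine ⟨⟨?_, ?_⟩, ?_, ?_⟩
  · rw [hL]
    gcongr
  · rw [hL]
    calc 2 * r / (ε₂ * d + S) ≤ 2 * R / (2 * (s * q)) := by
          gcongr
          linarith
      _ = R / (s * q) := by field_simp
  · rw [hμR, ← hs2, div_le_div_iff₀ hs (by positivity)]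
    have h3 : s * (2 * (s * q)) ≤ s * (ε₂ * d + S) := by
      gcongr
      linarith
    linarith
  · rw [hμR, ← hs2, div_le_div_iff₀ (by positivity) (by positivity)]
    have h3 : s * (ε₂ * d + S) ≤ s * (s * (D + T)) := by gcongr
    linarith
end
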